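/- Let ψ : ℝ → ℝ be a smooth function with ψ(θ) = 0 for |θ| ≤ 1, 0 ≤ ψ(θ) ≤ 1 for 1 ≤ |θ| ≤ 2, and ψ(θ) = 1 for |θ| ≥ 2. For ε ∈ (0,1] and k ∈ ℤ set z_ε(k) = (1/(2π)) ∫_{−π}^{π} e^{ikθ}(1 − ψ(θ/ε)) dθ and Δ_ε(k) = |z_ε(k) − z_ε(k−1)|. Then (a) Δ_ε(k) ≤ 2ε²/π for all k ∈ ℤ and all ε ∈ (0,1]; and (b) for each integer j ≥ 1 there exists a constant C_j > 0 (depending only on ψ and j) such that Δ_ε(k) ≤ C_j ε^{2−j} |k|^{−j} for all k ∈ ℤ \ {0} and all ε ∈ (0,1]. -/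

import Mathlib

open Filter Topology

/-- `z_ε(k) = (1/2π) ∫_{-π}^{π} e^{ikθ} (1 - ψ(θ/ε)) dθ`. -/
noncomputable def zSeq (ψ : ℝ → ℝ) (ε : ℝ) (k : ℤ) : ℂ :=
  (1 / (2 * Real.pi)) *
    ∫ θ in (-Real.pi)..Real.pi, Complex.exp (Complex.I * k * θ) * (1 - (ψ (θ / ε) : ℂ))

/-- `Δ_ε(k) = |z_ε(k) - z_ε(k-1)|`. -/
noncomputable def deltaSeq (ψ : ℝ → ℝ) (ε : ℝ) (k : ℤ) : ℝ :=
  ‖zSeq ψ ε k - zSeq ψ ε (k - 1)‖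

/-- One integration by parts against the character `u ↦ e^{iξu}`, without boundary terms. -/
lemma mul_integral_exp_mul_eq {f f' : ℝ → ℂ} {a b : ℝ} (hf : ∀ u, HasDerivAt f (f' u) u)
    (hf' : Continuous f') (ha : f a = 0) (hb : f b = 0) (ξ : ℝ) :
    (Complex.I * ξ) * ∫ u in a..b, Complex.exp (Complex.I * ξ * u) * f u =
      -∫ u in a..b, Complex.exp (Complex.I * ξ * u) * f' u := by
  have hv : ∀ u : ℝ, HasDerivAt (fun u : ℝ => Complex.exp (Complex.I * ξ * u))
      (Complex.exp (Complex.I * ξ * u) * (Complex.I * ξ)) u := fun u => by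
    simpa using ((hasDerivAt_id u).ofReal_comp.const_mul (Complex.I * (ξ : ℂ))).cexp
  have h := intervalIntegral.integral_mul_deriv_eq_deriv_mul (a := a) (b := b)
    (fun u _ => hf u) (fun u _ => hv u) (hf'.intervalIntegrable a b)
    ((by fun_prop : Continuous fun u : ℝ =>
      Complex.exp (Complex.I * ξ * u) * (Complex.I * ξ)).intervalIntegrable a b)
  rw [ha, hb] at h
  simp only [zero_mul, sub_zero, zero_sub] at h
  rw [← intervalIntegral.integral_const_mul]
  calc _ = ∫ u in a..b, f u * (Complex.exp (Complex.I * ξ * u) * (Complex.I * ξ)) :=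
        intervalIntegral.integral_congr fun u _ => by ring
    _ = _ := by
        rw [h]
        congr 1
        exact intervalIntegral.integral_congr fun u _ => mul_comm _ _

/-- Rapid decay of the Fourier transform of `g 0 i * φ`, uniformly in `i`, when `φ` is a smooth
bump and the iterated derivatives `g n i` of the family `g 0 i` are bounded uniformly in `i`. -/
lemma exists_integral_exp_mul_le {ι : Type*} {a b : ℝ} (hb : 0 ≤ b) (hab : b < a)
    {g : ℕ → ι → ℝ → ℂ} (hg : ∀ n i u, HasDerivAt (g n i) (g (n + 1) i u) u)
    (hbd : ∀ n, ∃ B, ∀ i, ∀ u, |u| ≤ a → ‖g n i u‖ ≤ B) (j : ℕ) :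
    ∀ (n : ℕ) (φ : ℝ → ℂ), ContDiff ℝ (⊤ : ℕ∞) φ → (∀ u, b < |u| → φ u = 0) →
      ∃ C, ∀ (i : ι) (ξ : ℝ),
        |ξ| ^ j * ‖∫ u in (-a)..a, Complex.exp (Complex.I * ξ * u) * (g n i u * φ u)‖ ≤ C := by
  have hgc : ∀ n i, Continuous (g n i) := fun n i =>
    continuous_iff_continuousAt.2 fun u => (hg n i u).continuousAt
  induction j with
  | zero =>
    intro n φ hφ _
    obtain ⟨B, hB⟩ := hbd n
    obtain ⟨D, hD⟩ := (isCompact_Icc (a := -a) (b := a)).exists_bound_of_continuousOn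
      hφ.continuous.continuousOn
    refine ⟨B * D * |a - -a|, fun i ξ => ?_⟩
    rw [pow_zero, one_mul]
    refine intervalIntegral.norm_integral_le_of_norm_le_const fun u hu => ?_
    rw [Set.uIoc_of_le (by linarith)] at hu
    have hu' : u ∈ Set.Icc (-a) a := Set.Ioc_subset_Icc_self hu
    have h1 := hB i u (abs_le.2 hu')
    have he : ‖Complex.exp (Complex.I * ξ * u)‖ = 1 := by
      rw [mul_assoc, ← Complex.ofReal_mul, Complex.norm_exp_I_mul_ofReal]
    rw [norm_mul, norm_mul, he, one_mul]
    exact mul_le_mul h1 (hD u hu') (norm_nonneg _) ((norm_nonneg _).trans h1)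
  | succ j ih =>
    intro n φ hφ hsupp
    have hφ' : ContDiff ℝ (⊤ : ℕ∞) (deriv φ) := (contDiff_infty_iff_deriv.1 hφ).2
    have hsupp' : ∀ u, b < |u| → deriv φ u = 0 := fun u hu => by
      have : φ =ᶠ[𝓝 u] fun _ => 0 :=
        (continuous_abs.continuousAt.eventually (lt_mem_nhds hu)).mono hsupp
      simpa using this.deriv_eq
    obtain ⟨C₁, h₁⟩ := ih (n + 1) φ hφ hsupp
    obtain ⟨C₂, h₂⟩ := ih n (deriv φ) hφ' hsupp'
    refine ⟨C₁ + C₂, fun i ξ => ?_⟩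
    have hφc := hφ.continuous
    have hφc' := hφ'.continuous
    have hc₁ := hgc n i
    have hc₂ := hgc (n + 1) i
    have hφd : ∀ u, HasDerivAt φ (deriv φ u) u := fun u =>
      ((contDiff_infty_iff_deriv.1 hφ).1 u).hasDerivAt
    have key := mul_integral_exp_mul_eq (a := -a) (b := a)
      (fun u => (hg n i u).fun_mul (hφd u)) (by fun_prop)
      (by rw [hsupp (-a) (by rw [abs_neg, abs_of_pos (hb.trans_lt hab)]; exact hab), mul_zero])
      (by rw [hsupp a (by rw [abs_of_pos (hb.trans_lt hab)]; exact hab), mul_zero]) ξ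
    simp only [mul_add] at key
    rw [intervalIntegral.integral_add
      (Continuous.intervalIntegrable (by fun_prop) _ _)
      (Continuous.intervalIntegrable (by fun_prop) _ _)] at key
    have hn := congrArg norm key
    rw [norm_neg, norm_mul, norm_mul, Complex.norm_I, one_mul, Complex.norm_real,
      Real.norm_eq_abs] at hn
    rw [pow_succ, mul_assoc, hn]
    calc _ ≤ |ξ| ^ j * (_ + _) := by gcongr; exact norm_add_le _ _
      _ ≤ C₁ + C₂ := by rw [mul_add]; exact add_le_add (h₁ i ξ) (h₂ i ξ)

/-- The difference `z_ε(k) - z_ε(k-1)` as an integral over an interval containing the support of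
the cutoff. -/
lemma zSeq_sub_zSeq {ψ : ℝ → ℝ} (hψ : Continuous ψ) (hψ1 : ∀ θ : ℝ, 2 ≤ |θ| → ψ θ = 1)
    {ε : ℝ} (hε : ε ∈ Set.Ioc (0 : ℝ) 1) (k : ℤ) :
    zSeq ψ ε k - zSeq ψ ε (k - 1) = (1 / (2 * Real.pi)) *
      ∫ θ : ℝ, Complex.exp (Complex.I * k * θ) * (1 - Complex.exp (-(Complex.I * θ))) *
        (1 - (ψ (θ / ε) : ℂ)) := by
  have hc : Continuous fun θ => ψ (θ / ε) := hψ.comp (continuous_id.div_const ε)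
  have hs : Function.support (fun θ : ℝ => Complex.exp (Complex.I * k * θ) *
      (1 - Complex.exp (-(Complex.I * θ))) * (1 - (ψ (θ / ε) : ℂ))) ⊆
      Set.Ioc (-Real.pi) Real.pi := fun θ hθ => by
    by_contra h
    refine hθ ?_
    have h2 : 2 ≤ |θ / ε| := by
      rw [abs_div, abs_of_pos hε.1, le_div_iff₀ hε.1]
      by_contra! h3
      have h4 : |θ| < Real.pi := by nlinarith [hε.2, Real.pi_gt_three]
      exact h ⟨(abs_lt.1 h4).1, (abs_lt.1 h4).2.le⟩
    simp [hψ1 _ h2]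
  rw [← intervalIntegral.integral_eq_integral_of_support_subset hs, zSeq, zSeq, ← mul_sub,
    ← intervalIntegral.integral_sub (Continuous.intervalIntegrable (by fun_prop) _ _)
      (Continuous.intervalIntegrable (by fun_prop) _ _)]
  congr 1
  refine intervalIntegral.integral_congr fun θ _ => ?_
  have : Complex.exp (Complex.I * ((k - 1 : ℤ) : ℂ) * θ) =
      Complex.exp (Complex.I * k * θ) * Complex.exp (-(Complex.I * θ)) := by
    rw [← Complex.exp_add]
    push_cast
    ring_nf
  simp only [this]
  ring

lemma norm_one_sub_exp_neg_I_mul_le (x : ℝ) : ‖1 - Complex.exp (-(Complex.I * x))‖ ≤ |x| := by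
  have h := Real.norm_exp_I_mul_ofReal_sub_one_le (x := -x)
  rw [norm_sub_rev] at h
  simpa using h

lemma integral_abs_neg_self {a : ℝ} (ha : 0 ≤ a) : ∫ θ in (-a)..a, |θ| = a ^ 2 := by
  rw [← intervalIntegral.integral_add_adjacent_intervals (b := 0)
    (continuous_abs.intervalIntegrable _ _) (continuous_abs.intervalIntegrable _ _)]
  have h1 : ∫ θ in (-a)..0, |θ| = ∫ θ in (-a)..0, -θ :=
    intervalIntegral.integral_congr fun θ hθ => by
      rw [Set.uIcc_of_le (by linarith)] at hθ
      exact abs_of_nonpos hθ.2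
  have h2 : ∫ θ in (0 : ℝ)..a, |θ| = ∫ θ in (0 : ℝ)..a, θ :=
    intervalIntegral.integral_congr fun θ hθ => by
      rw [Set.uIcc_of_le ha] at hθ
      exact abs_of_nonneg hθ.1
  rw [h1, h2, intervalIntegral.integral_neg, integral_id, integral_id]
  ring

lemma deltaSeq_le {ψ : ℝ → ℝ} (hψ : Continuous ψ) (hψ01 : ∀ θ, ψ θ ∈ Set.Icc (0 : ℝ) 1)
    (hψ1 : ∀ θ : ℝ, 2 ≤ |θ| → ψ θ = 1) {ε : ℝ} (hε : ε ∈ Set.Ioc (0 : ℝ) 1) (k : ℤ) :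
    deltaSeq ψ ε k ≤ 2 * ε ^ 2 / Real.pi := by
  have hε0 := hε.1
  have hs : Function.support (fun θ : ℝ => Complex.exp (Complex.I * k * θ) *
      (1 - Complex.exp (-(Complex.I * θ))) * (1 - (ψ (θ / ε) : ℂ))) ⊆
      Set.Ioc (-(2 * ε)) (2 * ε) := fun θ hθ => by
    by_contra h
    refine hθ ?_
    have h2 : 2 ≤ |θ / ε| := by
      rw [abs_div, abs_of_pos hε0, le_div_iff₀ hε0]
      by_contra! h3
      exact h ⟨(abs_lt.1 h3).1, (abs_lt.1 h3).2.le⟩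
    simp [hψ1 _ h2]
  rw [deltaSeq, zSeq_sub_zSeq hψ hψ1 hε,
    ← intervalIntegral.integral_eq_integral_of_support_subset hs, norm_mul]
  have hI : ‖∫ θ in (-(2 * ε))..(2 * ε), Complex.exp (Complex.I * k * θ) *
      (1 - Complex.exp (-(Complex.I * θ))) * (1 - (ψ (θ / ε) : ℂ))‖ ≤ (2 * ε) ^ 2 := by
    rw [← integral_abs_neg_self (by positivity : 0 ≤ 2 * ε)]
    refine intervalIntegral.norm_integral_le_of_norm_le (by linarith)
      (Eventually.of_forall fun θ _ => ?_) (continuous_abs.intervalIntegrable _ _)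
    have he : ‖Complex.exp (Complex.I * k * θ)‖ = 1 := by
      rw [mul_assoc, ← Complex.ofReal_intCast, ← Complex.ofReal_mul,
        Complex.norm_exp_I_mul_ofReal]
    have hp : ‖1 - (ψ (θ / ε) : ℂ)‖ ≤ 1 := by
      rw [← Complex.ofReal_one, ← Complex.ofReal_sub, Complex.norm_real, Real.norm_eq_abs, abs_le]
      constructor <;> linarith [(hψ01 (θ / ε)).1, (hψ01 (θ / ε)).2]
    rw [norm_mul, norm_mul, he, one_mul]
    exact (mul_le_of_le_one_right (norm_nonneg _) hp).trans (norm_one_sub_exp_neg_I_mul_le θ)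
  have hn : ‖(1 / (2 * Real.pi) : ℂ)‖ = 1 / (2 * Real.pi) := by
    simp [abs_of_pos Real.pi_pos]
  rw [hn]
  calc _ ≤ 1 / (2 * Real.pi) * (2 * ε) ^ 2 := by gcongr
    _ = _ := by field_simp

/-- `u ↦ (1 - e^{-iεu})/ε` and its iterated derivatives. -/
noncomputable def quotientDeriv : ℕ → ℝ → ℝ → ℂ
  | 0, ε, u => (1 - Complex.exp (-(Complex.I * (ε * u : ℝ)))) / ε
  | n + 1, ε, u => Complex.I * (-(Complex.I * ε)) ^ n * Complex.exp (-(Complex.I * (ε * u : ℝ)))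

lemma hasDerivAt_quotientDeriv {ε : ℝ} (hε : ε ≠ 0) (n : ℕ) (u : ℝ) :
    HasDerivAt (quotientDeriv n ε) (quotientDeriv (n + 1) ε u) u := by
  have hε' : (ε : ℂ) ≠ 0 := Complex.ofReal_ne_zero.2 hε
  have h : HasDerivAt (fun u : ℝ => Complex.exp (-(Complex.I * (ε * u : ℝ))))
      (Complex.exp (-(Complex.I * (ε * u : ℝ))) * (-(Complex.I * ε))) u := by
    have := (((hasDerivAt_id u).const_mul ε).ofReal_comp.const_mul Complex.I).neg.cexp
    simpa using this
  cases n with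
  | zero =>
    refine ((h.const_sub 1).div_const (ε : ℂ)).congr_deriv ?_
    rw [quotientDeriv]
    field_simp
  | succ n =>
    refine (h.const_mul (Complex.I * (-(Complex.I * ε)) ^ n)).congr_deriv ?_
    rw [quotientDeriv]
    ring

lemma norm_quotientDeriv_le {ε : ℝ} (hε : ε ∈ Set.Ioc (0 : ℝ) 1) (n : ℕ) (u : ℝ) :
    ‖quotientDeriv n ε u‖ ≤ max 1 |u| := by
  have hε0 := hε.1
  cases n with
  | zero =>
    refine le_max_of_le_right ?_
    rw [quotientDeriv, norm_div, Complex.norm_real, Real.norm_of_nonneg hε0.le, div_le_iff₀ hε0]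
    refine (norm_one_sub_exp_neg_I_mul_le (ε * u)).trans_eq ?_
    rw [abs_mul, abs_of_pos hε0, mul_comm]
  | succ n =>
    refine le_max_of_le_left ?_
    have he : ‖Complex.exp (-(Complex.I * (ε * u : ℝ)))‖ = 1 := by
      have := Complex.norm_exp_I_mul_ofReal (-(ε * u))
      rwa [Complex.ofReal_neg, mul_neg] at this
    rw [quotientDeriv, norm_mul, norm_mul, norm_pow, norm_neg, norm_mul, he, Complex.norm_I,
      Complex.norm_real, Real.norm_of_nonneg hε0.le, one_mul, one_mul, mul_one]
    exact pow_le_one₀ hε0.le hε.2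

/-- Rescaling `θ = εu` in the integral for `Δ_ε(k)`. -/
lemma deltaSeq_eq {ψ : ℝ → ℝ} (hψ : Continuous ψ) (hψ1 : ∀ θ : ℝ, 2 ≤ |θ| → ψ θ = 1)
    {ε : ℝ} (hε : ε ∈ Set.Ioc (0 : ℝ) 1) (k : ℤ) :
    deltaSeq ψ ε k = ε ^ 2 / (2 * Real.pi) *
      ‖∫ u in (-3 : ℝ)..3, Complex.exp (Complex.I * (k * ε : ℝ) * u) *
        (quotientDeriv 0 ε u * (1 - (ψ u : ℂ)))‖ := by
  have hε0 := hε.1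
  have hε' : (ε : ℂ) ≠ 0 := Complex.ofReal_ne_zero.2 hε0.ne'
  have hs : Function.support (fun u : ℝ => Complex.exp (Complex.I * (k * ε : ℝ) * u) *
      (quotientDeriv 0 ε u * (1 - (ψ u : ℂ)))) ⊆ Set.Ioc (-3) 3 := fun u hu => by
    by_contra h
    refine hu ?_
    have h2 : 2 ≤ |u| := by
      by_contra! h3
      exact h ⟨by linarith [(abs_lt.1 h3).1], by linarith [(abs_lt.1 h3).2]⟩
    simp [hψ1 _ h2]
  have hscale := MeasureTheory.Measure.integral_comp_mul_left (fun θ : ℝ =>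
    Complex.exp (Complex.I * k * θ) * (1 - Complex.exp (-(Complex.I * θ))) *
      (1 - (ψ (θ / ε) : ℂ))) ε
  have hpt : ∀ u : ℝ, Complex.exp (Complex.I * k * (ε * u : ℝ)) *
      (1 - Complex.exp (-(Complex.I * (ε * u : ℝ)))) * (1 - (ψ (ε * u / ε) : ℂ)) =
      ε * (Complex.exp (Complex.I * (k * ε : ℝ) * u) *
        (quotientDeriv 0 ε u * (1 - (ψ u : ℂ)))) := fun u => by
    rw [mul_div_cancel_left₀ u hε0.ne', quotientDeriv]
    have : Complex.I * k * (ε * u : ℝ) = Complex.I * (k * ε : ℝ) * u := by push_cast; ring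
    rw [this]
    field_simp
  simp only [hpt] at hscale
  rw [MeasureTheory.integral_const_mul,
    ← intervalIntegral.integral_eq_integral_of_support_subset hs] at hscale
  have hn := congrArg norm hscale
  rw [norm_mul, norm_smul, Complex.norm_real, Real.norm_of_nonneg hε0.le, norm_abs_eq_norm,
    norm_inv, Real.norm_of_nonneg hε0.le, eq_inv_mul_iff_mul_eq₀ hε0.ne'] at hn
  have hpi : ‖(1 / (2 * Real.pi) : ℂ)‖ = 1 / (2 * Real.pi) := by
    simp [abs_of_pos Real.pi_pos]
  rw [deltaSeq, zSeq_sub_zSeq hψ hψ1 hε, norm_mul, hpi, ← hn]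
  ring

/-- Pointwise bounds on `Δ_ε`: (a) `Δ_ε(k) ≤ 2ε²/π` for all `k`; (b) for each `j ≥ 1` there
is `C_j > 0` with `Δ_ε(k) ≤ C_j ε²/(εʲ |k|ʲ)` for all `k ≠ 0` and `ε ∈ (0,1]`. -/
theorem deltaSeq_bounds (ψ : ℝ → ℝ) (hψ : ContDiff ℝ (⊤ : ℕ∞) ψ)
    (hψ0 : ∀ θ : ℝ, |θ| ≤ 1 → ψ θ = 0)
    (hψ01 : ∀ θ : ℝ, 1 ≤ |θ| → |θ| ≤ 2 → ψ θ ∈ Set.Icc (0:ℝ) 1)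
    (hψ1 : ∀ θ : ℝ, 2 ≤ |θ| → ψ θ = 1) :
    (∀ ε ∈ Set.Ioc (0:ℝ) 1, ∀ k : ℤ, deltaSeq ψ ε k ≤ 2 * ε ^ 2 / Real.pi) ∧
    (∀ j : ℕ, 1 ≤ j → ∃ C > (0:ℝ), ∀ ε ∈ Set.Ioc (0:ℝ) 1, ∀ k : ℤ, k ≠ 0 →
      deltaSeq ψ ε k ≤ C * ε ^ 2 / (ε ^ j * |(k : ℝ)| ^ j)) := by
  have h01 : ∀ θ, ψ θ ∈ Set.Icc (0 : ℝ) 1 := fun θ => by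
    rcases le_total |θ| 1 with h | h
    · simp [hψ0 θ h]
    rcases le_total |θ| 2 with h' | h'
    · exact hψ01 θ h h'
    · simp [hψ1 θ h']
  refine ⟨fun ε hε k => deltaSeq_le hψ.continuous h01 hψ1 hε k, fun j _ => ?_⟩
  have hφ : ContDiff ℝ (⊤ : ℕ∞) fun u => 1 - (ψ u : ℂ) :=
    contDiff_const.sub (Complex.ofRealCLM.contDiff.comp hψ)
  obtain ⟨C, hC⟩ := exists_integral_exp_mul_le (ι := Set.Ioc (0 : ℝ) 1)
    (a := 3) (b := 2) zero_le_two (by norm_num) (g := fun n ε => quotientDeriv n ε)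
    (fun n ε u => hasDerivAt_quotientDeriv ε.2.1.ne' n u)
    (fun n => ⟨3, fun ε u hu =>
      (norm_quotientDeriv_le ε.2 n u).trans (max_le (by norm_num) hu)⟩)
    j 0 _ hφ (fun u hu => by simp [hψ1 u hu.le])
  have hC0 : 0 ≤ C := le_trans (by positivity) (hC ⟨1, by simp⟩ 0)
  refine ⟨C + 1, by positivity, fun ε hε k hk => ?_⟩
  have hε0 := hε.1
  have hk' : 0 < |(k : ℝ)| := abs_pos.2 (Int.cast_ne_zero.2 hk)
  have h := hC ⟨ε, hε⟩ (k * ε)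
  rw [abs_mul, abs_of_pos hε0, mul_pow] at h
  rw [deltaSeq_eq hψ.continuous hψ1 hε, le_div_iff₀ (by positivity)]
  have hpi : 1 / (2 * Real.pi) ≤ 1 := by
    rw [div_le_one (by positivity)]
    linarith [Real.pi_gt_three]
  calc _ = ε ^ 2 * (1 / (2 * Real.pi)) * (|(k : ℝ)| ^ j * ε ^ j *
        ‖∫ u in (-3 : ℝ)..3, Complex.exp (Complex.I * (k * ε : ℝ) * u) *
          (quotientDeriv 0 ε u * (1 - (ψ u : ℂ)))‖) := by ring
    _ ≤ ε ^ 2 * 1 * (C + 1) := by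
        gcongr
        exact h.trans (by linarith)
    _ = _ := by ring
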